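/- Let K be an algebraically closed field, let A be a finitely generated commutative K-algebra that is an integral domain, let q be a maximal ideal of A, and let t ∈ q be a nonzero element. Then there exists a prime ideal q' of A such that q' ⊆ q, t ∉ q', and the Krull dimension of the quotient ring A/q' is equal to 1. -/

import Mathlib

/-- In a Noetherian domain, if every nonzero prime inside the maximal ideal `m` contains the
nonzero element `t ∈ m`, then `m` has height at most one. -/
theorem height_le_one_aux {B : Type*} [CommRing B] [IsDomain B] [IsNoetherianRing B]
    (m : Ideal B) [hm : m.IsMaximal] (t : B) (ht0 : t ≠ 0) (htm : t ∈ m)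
    (h : ∀ p : Ideal B, p.IsPrime → p ≤ m → p ≠ ⊥ → t ∈ p) : m.height ≤ 1 := by
  have hfin : (Ideal.span {t}).minimalPrimes.Finite :=
    Ideal.finite_minimalPrimes_of_isNoetherianRing B _
  by_cases hU : (m : Set B) ⊆ ⋃ i ∈ ((hfin.toFinset : Finset (Ideal B)) : Set (Ideal B)), (i : Set B)
  · obtain ⟨p, hp, hmp⟩ := (Ideal.subset_union_prime (f := fun i : Ideal B => i) ⊥ ⊥
      (fun i hi _ _ => ((hfin.mem_toFinset).1 hi).1.1)).1 hU
    have hp' := (hfin.mem_toFinset).1 hp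
    have : m = p := hm.eq_of_le hp'.1.1.ne_top hmp
    rw [this]
    exact Ideal.height_le_one_of_isPrincipal_of_mem_minimalPrimes (Ideal.span {t}) p hp'
  · exfalso
    rw [Set.not_subset] at hU
    obtain ⟨x, hxm, hx⟩ := hU
    have hx' : ∀ p ∈ (Ideal.span {t}).minimalPrimes, x ∉ p := by
      intro p hp hxp
      exact hx (Set.mem_biUnion (by simpa using hp) hxp)
    obtain ⟨p, hp, hpm⟩ := Ideal.exists_minimalPrimes_le
      (I := Ideal.span {x}) (J := m) (by simpa [Ideal.span_le] using hxm)
    have hpp : p.IsPrime := hp.1.1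
    have hxp : x ∈ p := hp.1.2 (Ideal.mem_span_singleton_self x)
    have hx0 : x ≠ 0 := by
      rintro rfl
      obtain ⟨r, hr, _⟩ := Ideal.exists_minimalPrimes_le
        (I := Ideal.span {t}) (J := m) (by simpa [Ideal.span_le] using htm)
      exact hx' r hr r.zero_mem
    have hpb : p ≠ ⊥ := by
      rintro rfl
      exact hx0 (by simpa using hxp)
    have htp := h p hpp hpm hpb
    obtain ⟨r, hr, hrp⟩ := Ideal.exists_minimalPrimes_le
      (I := Ideal.span {t}) (J := p) (by simpa [Ideal.span_le] using htp)
    have hrprime : r.IsPrime := hr.1.1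
    have htr : t ∈ r := hr.1.2 (Ideal.mem_span_singleton_self t)
    have hlt : r < p := lt_of_le_of_ne hrp (by rintro rfl; exact hx' _ hr hxp)
    have hbr : (⊥ : Ideal B) < r := by
      rw [bot_lt_iff_ne_bot]
      rintro rfl
      exact ht0 (by simpa using htr)
    have h1 := Ideal.height_add_one_le_of_lt_of_isPrime hbr
    have h2 := Ideal.height_add_one_le_of_lt_of_isPrime hlt
    have h3 := Ideal.height_le_one_of_isPrincipal_of_mem_minimalPrimes (Ideal.span {x}) p hp
    rw [Ideal.height_bot] at h1
    have h4 : (1 : ℕ∞) + 1 ≤ 1 := by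
      calc (1 : ℕ∞) + 1 ≤ r.height + 1 := by gcongr; simpa using h1
        _ ≤ _ := h2
        _ ≤ 1 := h3
    revert h4
    decide

/-- Maximal ideals of `K[x₁, …, xₙ]` have height `n`. -/
theorem height_mvPolynomial_aux (K : Type*) [Field K] (n : ℕ)
    (M : Ideal (MvPolynomial (Fin n) K)) (hM : M.IsMaximal) : M.height = n := by
  induction n with
  | zero =>
    let e := (MvPolynomial.isEmptyRingEquiv K (Fin 0))
    have hf : IsField (MvPolynomial (Fin 0) K) := e.toMulEquiv.isField (Field.toIsField K)
    let _ := hf.toField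
    have : M = ⊥ := by
      by_contra hne
      obtain ⟨x, hx, hx0⟩ := Submodule.exists_mem_ne_zero_of_ne_bot hne
      obtain ⟨y, hy⟩ := hf.mul_inv_cancel hx0
      exact hM.ne_top ((Ideal.eq_top_iff_one _).2 (hy ▸ M.mul_mem_right y hx))
    rw [this, Ideal.height_bot]
    simp
  | succ n ih =>
    let e := (MvPolynomial.finSuccEquiv K n).toRingEquiv
    let P : Ideal (Polynomial (MvPolynomial (Fin n) K)) := M.comap e.symm
    have hP : P.IsMaximal := Ideal.comap_isMaximal_of_equiv e.symm
    have h1 : P.height = M.height := e.symm.height_comap M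
    have hp : (P.comap Polynomial.C).IsMaximal :=
      Polynomial.isMaximal_comap_C_of_isJacobsonRing P
    have : P.LiesOver (P.comap Polynomial.C) := ⟨rfl⟩
    rw [← h1, Polynomial.height_eq_height_add_one (P.comap Polynomial.C) P, ih _ hp]
    simp

/-- The dimension of an affine domain is at most the height of any maximal ideal. -/
theorem dim_le_height_aux (K B : Type*) [Field K] [CommRing B] [IsDomain B] [Algebra K B]
    [Algebra.FiniteType K B] (m : Ideal B) [hm : m.IsMaximal] :
    ringKrullDim B ≤ m.height := by
  obtain ⟨n, g, hinj, hint⟩ := exists_integral_inj_algHom_of_fg K B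
  have : IsNoetherianRing B := Algebra.FiniteType.isNoetherianRing K B
  algebraize [g.toRingHom]
  have hI : Algebra.IsIntegral (MvPolynomial (Fin n) K) B := ⟨hint⟩
  have : FaithfulSMul (MvPolynomial (Fin n) K) B :=
    (faithfulSMul_iff_algebraMap_injective _ _).2 hinj
  let p := m.under (MvPolynomial (Fin n) K)
  have hp : p.IsMaximal := Ideal.isMaximal_comap_of_isIntegral_of_isMaximal m
  have h1 := Ideal.height_eq_height_add_of_liesOver_of_hasGoingDown p m
  have h2 := height_mvPolynomial_aux K n p hp
  have h3 : (n : ℕ∞) ≤ m.height := by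
    rw [h1, h2]; exact le_self_add
  have h4 : ringKrullDim B ≤ ringKrullDim (MvPolynomial (Fin n) K) := by
    refine Order.krullDim_le_of_strictMono
      (PrimeSpectrum.comap (algebraMap (MvPolynomial (Fin n) K) B)) ?_
    intro a b hab
    exact Ideal.IsIntegral.comap_lt_comap (I := a.asIdeal) (J := b.asIdeal) hab
  refine h4.trans ?_
  rw [MvPolynomial.ringKrullDim_of_isNoetherianRing]
  simp only [ringKrullDim_eq_zero_of_field, zero_add, Nat.card_eq_fintype_card, Fintype.card_fin]
  exact_mod_cast h3

theorem exists_prime_of_dim_one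
    (K A : Type*) [Field K] [IsAlgClosed K] [CommRing A] [IsDomain A]
    [Algebra K A] (hfg : Algebra.FiniteType K A)
    (q : Ideal A) (hq : q.IsMaximal) (t : A) (htq : t ∈ q) (ht0 : t ≠ 0) :
    ∃ q' : Ideal A, q'.IsPrime ∧ q' ≤ q ∧ t ∉ q' ∧ ringKrullDim (A ⧸ q') = 1 := by
  have : IsNoetherianRing A := Algebra.FiniteType.isNoetherianRing K A
  obtain ⟨q', ⟨hq'p, hq'q, htq'⟩, hmax⟩ := set_has_maximal_iff_noetherian.2 this
    {p : Ideal A | p.IsPrime ∧ p ≤ q ∧ t ∉ p}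
    ⟨⊥, Ideal.isPrime_bot, bot_le, by simpa using ht0⟩
  refine ⟨q', hq'p, hq'q, htq', ?_⟩
  let π := Ideal.Quotient.mk q'
  have hπ : Function.Surjective π := Ideal.Quotient.mk_surjective
  let m : Ideal (A ⧸ q') := q.map π
  have hcomap : m.comap π = q := by
    rw [Ideal.comap_map_of_surjective π hπ, ← RingHom.ker_eq_comap_bot, Ideal.mk_ker]
    exact sup_eq_left.2 hq'q
  have hm : m.IsMaximal := by
    refine (Ideal.map_eq_top_or_isMaximal_of_surjective π hπ hq).resolve_left ?_
    intro htop
    apply hq.ne_top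
    rw [← hcomap]
    change (q.map π).comap π = ⊤
    rw [htop, Ideal.comap_top]
  have hmt : π t ≠ 0 := fun h0 => htq' (Ideal.Quotient.eq_zero_iff_mem.1 h0)
  have htm : π t ∈ m := Ideal.mem_map_of_mem π htq
  have hle : m.height ≤ 1 := by
    refine height_le_one_aux m (π t) hmt htm ?_
    intro p hp hpm hpb
    by_contra htp
    refine hmax (p.comap π) ⟨hp.comap π, hcomap ▸ Ideal.comap_mono hpm, htp⟩ ?_
    have h0 : q' = (⊥ : Ideal (A ⧸ q')).comap π := by
      rw [← RingHom.ker_eq_comap_bot, Ideal.mk_ker]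
    refine lt_of_le_of_ne (h0.le.trans (Ideal.comap_mono bot_le)) ?_
    intro heq
    apply hpb
    exact Ideal.comap_injective_of_surjective π hπ (heq.symm.trans h0)
  have hne : m ≠ ⊥ := by
    intro hb
    rw [hb] at htm
    exact hmt (by simpa using htm)
  have hge : 1 ≤ m.height := by
    rw [Order.one_le_iff_ne_zero, Ne, Ideal.height_eq_zero_iff_eq_bot]
    exact hne
  have heq : m.height = 1 := le_antisymm hle hge
  refine le_antisymm ?_ ?_
  · have := dim_le_height_aux K (A ⧸ q') m
    rw [heq] at this
    exact_mod_cast this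
  · have := Ideal.height_le_ringKrullDim_of_ne_top hm.ne_top
    rw [heq] at this
    exact_mod_cast this
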